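/- Soundness of the lazy refinement loop (correctness of Algorithm 1 when it returns SAFE): Let G̃ be defined exactly like the game G^∃ except that transition rule (1) allows any edge (ŝ, q, b) → (ŝ, q, b, M, A) with ∅ ≠ A ⊆ Succ_M(ŝ) = { ŝ' | ŝ →_M ŝ' } (no validity check), while rules (2) and (3) are unchanged. Under the assumptions of Theorem 3 (init = {c_0} a singleton; the lifted initial set, the lifted observation sets Ξ_i, and all automaton edge labels are expressible in the abstraction; for every trace t of the transition system and every l+1 ≤ i ≤ k, ξ_i is a valid observation on t), if SAFE has a positional winning strategy σ in G̃ such that valid(ŝ, M, A) holds for every edge (ŝ, q, b) → (ŝ, q, b, M, A) prescribed by σ, then for all traces t_1, …, t_l of the transition system with ξ_i a valid observation on t_i for each 1 ≤ i ≤ l, there exist traces t_{l+1}, …, t_k of the transition system such that the word w(j) = (t_1|ξ_1(j), …, t_k|ξ_k(j)) is accepted by A. -/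

import Mathlib

/-- A trace of the transition system `(init, step)`. -/
def IsTrace {C : Type*} (init : Set C) (step : Set (C × C)) (t : ℕ → C) : Prop :=
  t 0 ∈ init ∧ ∀ i, (t i, t (i + 1)) ∈ step

/-- `ξ` is a valid observation on `t` if `t i ∈ ξ` for infinitely many `i`. -/
def ValidObs {S : Type*} (ξ : Set S) (t : ℕ → S) : Prop :=
  {i : ℕ | t i ∈ ξ}.Infinite

/-- The filtered trace `t|ξ`: its `i`-th value is `t j` where `j` is the `i`-th index
(in increasing order) with `t j ∈ ξ`. -/
noncomputable def filterTrace {S : Type*} (t : ℕ → S) (ξ : Set S) : ℕ → S :=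
  fun i => t (Nat.nth (fun j => t j ∈ ξ) i)

/-- The concretization of an abstract state `s ∈ 𝔹ⁿ` w.r.t. the predicates `p`:
all elements on which predicate `p i` holds iff `s i = true`. -/
def conc {D : Type*} {n : ℕ} (p : Fin n → Set D) (s : Fin n → Bool) : Set D :=
  {d | ∀ i, d ∈ p i ↔ s i = true}

/-- A set is expressible in the abstraction if membership only depends on the
truth values of the predicates `p`. -/
def Expressible {D : Type*} {n : ℕ} (p : Fin n → Set D) (Y : Set D) : Prop :=
  ∀ d d', (∀ i, d ∈ p i ↔ d' ∈ p i) → (d ∈ Y ↔ d' ∈ Y)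

/-- `c'` is an `M`-step from `c`: every copy in the scheduling `M` takes a `step`,
all other copies stay put. -/
def MStep {C : Type*} {k : ℕ} (step : Set (C × C)) (M : Set (Fin k)) (c c' : Fin k → C) : Prop :=
  ∀ i, (i ∈ M → (c i, c' i) ∈ step) ∧ (i ∉ M → c' i = c i)

/-- `s'` is an `M`-successor of `s` (written `s →_M s'`). -/
def MSucc {C : Type*} {k n : ℕ} (p : Fin n → Set (Fin k → C)) (step : Set (C × C))
    (M : Set (Fin k)) (s s' : Fin n → Bool) : Prop :=
  ∃ c ∈ conc p s, ∃ c', MStep step M c c' ∧ c' ∈ conc p s'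

/-- `R` is a valid restriction for the abstract state `s` and scheduling `M`
(copies `i` with `(i : ℕ) < l` are universal, the remaining copies are existential):
for every concrete state in `⟦s⟧` and every move of the scheduled universal copies,
the scheduled existential copies can move such that the resulting tuple lies in the
concretization of some abstract state in `R`. -/
def ValidRes {C : Type*} {k n : ℕ} (step : Set (C × C)) (p : Fin n → Set (Fin k → C))
    (l : ℕ) (s : Fin n → Bool) (M : Set (Fin k)) (R : Set (Fin n → Bool)) : Prop :=
  ∀ c ∈ conc p s, ∀ cu : Fin k → C,
    (∀ i : Fin k, (i : ℕ) < l → ((i ∈ M → (c i, cu i) ∈ step) ∧ (i ∉ M → cu i = c i))) →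
    ∃ c' : Fin k → C,
      (∀ i : Fin k, (i : ℕ) < l → c' i = cu i) ∧
      (∀ i : Fin k, l ≤ (i : ℕ) → ((i ∈ M → (c i, c' i) ∈ step) ∧ (i ∉ M → c' i = c i))) ∧
      ∃ s' ∈ R, c' ∈ conc p s'

/-- A deterministic symbolic safety automaton over the alphabet `σ`: a finite set of
states `Q` with initial state `q0`, a finite set of edges `(q, E, q')` whose labels `E`
are sets of letters, and bad states `Bad`, such that for every state `q` and letter `a`
there is exactly one edge from `q` whose label contains `a`. -/
structure DSA (σ : Type*) where
  Q : Type*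
  finQ : Finite Q
  q0 : Q
  edges : Set (Q × Set σ × Q)
  finEdges : edges.Finite
  Bad : Set Q
  det : ∀ (q : Q) (a : σ), ∃! e : Q × Set σ × Q, e ∈ edges ∧ e.1 = q ∧ a ∈ e.2.1

/-- `r` is the run of `A` on the infinite word `w`. -/
def IsRun {σ : Type*} (A : DSA σ) (w : ℕ → σ) (r : ℕ → A.Q) : Prop :=
  r 0 = A.q0 ∧ ∀ j, ∃ E, (r j, E, r (j + 1)) ∈ A.edges ∧ w j ∈ E

/-- `w` is accepted by `A` if its run never visits a bad state. -/
def Accepted {σ : Type*} (A : DSA σ) (w : ℕ → σ) : Prop :=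
  ∀ r : ℕ → A.Q, IsRun A w r → ∀ j, r j ∉ A.Bad

/-- `obsAt p ξ s i` holds iff copy `i` is at an observation point in the abstract
state `s`, i.e. `⟦s⟧` intersects the lifted observation set `Ξ_i = {c | c i ∈ ξ i}`. -/
def obsAt {C : Type*} {k n : ℕ} (p : Fin n → Set (Fin k → C)) (ξ : Fin k → Set C)
    (s : Fin n → Bool) (i : Fin k) : Prop :=
  (conc p s ∩ {c : Fin k → C | c i ∈ ξ i}).Nonempty

/-- `σ` is a winning positional strategy for player SAFE in the safety game with edge
relation `Edge`, initial states `Init`, bad states `Bad` and SAFE-owned states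
`IsSafeSt`: `σ` picks, at every SAFE-state, a transition successor, and no (prefix of a)
play starting in an initial state, following the edges, and taking the prescribed move
at every SAFE-state ever visits a bad state. -/
def GWinning {St : Type*} (Edge : St → St → Prop) (Init Bad IsSafeSt : St → Prop)
    (σ : St → St) : Prop :=
  (∀ st, IsSafeSt st → Edge st (σ st)) ∧
  ∀ (pl : ℕ → St) (m : ℕ), Init (pl 0) →
    (∀ i < m, Edge (pl i) (pl (i + 1)) ∧ (IsSafeSt (pl i) → pl (i + 1) = σ (pl i))) →
    ¬ Bad (pl m)

/-- Game states of the games `G^∃` and `G̃`: SAFE-states `(ŝ, q, b)` and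
REACH-states `(ŝ, q, b, M, R)` carrying a scheduling `M` and a restriction `R`. -/
inductive GSE (n k : ℕ) (Q : Type*) where
  | safe (s : Fin n → Bool) (q : Q) (b : Fin k → Bool)
  | reach (s : Fin n → Bool) (q : Q) (b : Fin k → Bool) (M : Set (Fin k)) (R : Set (Fin n → Bool))

/-- SAFE-owned states. -/
def GIsSafeE {n k : ℕ} {Q : Type*} : GSE n k Q → Prop
  | .safe _ _ _ => True
  | .reach _ _ _ _ _ => False

/-- Initial states: all `(ŝ, q₀, ⊤^k)` with `⟦ŝ⟧` intersecting the lifted initial set. -/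
def GInitE {C : Type*} {n k : ℕ} (p : Fin n → Set (Fin k → C)) (init : Set C)
    (Aut : DSA (Fin k → C)) (st : GSE n k Aut.Q) : Prop :=
  ∃ s : Fin n → Bool, st = GSE.safe s Aut.q0 (fun _ => true) ∧
    (conc p s ∩ {c : Fin k → C | ∀ i, c i ∈ init}).Nonempty

/-- Bad states: those whose automaton component is bad. -/
def GBadE {n k : ℕ} {Q : Type*} (B : Set Q) : GSE n k Q → Prop
  | .safe _ q _ => q ∈ B
  | .reach _ q _ _ _ => q ∈ B

/-- Transitions of the relaxed game `G̃` of the lazy solver (Algorithm 1): defined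
exactly like `G^∃`, except that rule (1) allows *any* nonempty restriction
`R ⊆ Succ_M(ŝ)` of the `M`-successors of `ŝ` (no validity check); rules (2) and (3)
are unchanged. -/
inductive GEdgeTilde {C : Type*} {k n : ℕ} (p : Fin n → Set (Fin k → C)) (step : Set (C × C))
    (ξ : Fin k → Set C) (Aut : DSA (Fin k → C)) :
    GSE n k Aut.Q → GSE n k Aut.Q → Prop where
  | sched {s : Fin n → Bool} {q : Aut.Q} {b : Fin k → Bool} {M : Set (Fin k)}
      {R : Set (Fin n → Bool)} :
      M.Nonempty →
      (∀ i ∈ M, b i = false ∨ ¬ obsAt p ξ s i) →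
      R.Nonempty →
      R ⊆ {s' | MSucc p step M s s'} →
      GEdgeTilde p step ξ Aut (.safe s q b) (.reach s q b M R)
  | auto {s : Fin n → Bool} {q q' : Aut.Q} {E : Set (Fin k → C)} :
      (∀ i, obsAt p ξ s i) →
      (q, E, q') ∈ Aut.edges →
      (conc p s ∩ E).Nonempty →
      GEdgeTilde p step ξ Aut (.safe s q (fun _ => true)) (.safe s q' (fun _ => false))
  | move {s s' : Fin n → Bool} {q : Aut.Q} {b b' : Fin k → Bool} {M : Set (Fin k)}
      {R : Set (Fin n → Bool)} :
      s' ∈ R →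
      (∀ i ∈ M, b' i = true) →
      (∀ i ∉ M, b' i = b i) →
      GEdgeTilde p step ξ Aut (.reach s q b M R) (.safe s' q b')
/-- The abstract state describing a concrete element. -/
noncomputable def absState {D : Type*} {n : ℕ} (p : Fin n → Set D) (d : D) : Fin n → Bool :=
  open Classical in fun i => decide (d ∈ p i)

theorem mem_conc_iff {D : Type*} {n : ℕ} {p : Fin n → Set D} {s : Fin n → Bool} {d : D} :
    d ∈ conc p s ↔ s = absState p d := by
  classical
  constructor
  · intro h
    funext i
    have := h i
    by_cases hd : d ∈ p i <;> simp_all [absState]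
  · rintro rfl i
    simp [absState]

theorem mem_conc_absState {D : Type*} {n : ℕ} (p : Fin n → Set D) (d : D) :
    d ∈ conc p (absState p d) :=
  mem_conc_iff.2 rfl

theorem Expressible.conc_inter_nonempty_iff {D : Type*} {n : ℕ} {p : Fin n → Set D} {Y : Set D}
    (hY : Expressible p Y) (d : D) : (conc p (absState p d) ∩ Y).Nonempty ↔ d ∈ Y := by
  constructor
  · rintro ⟨d', hd', hY'⟩
    exact (hY d d' fun i => (mem_conc_absState p d i).trans (hd' i).symm).2 hY'
  · exact fun h => ⟨d, mem_conc_absState p d, h⟩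

/-- Game states visited by plays compatible with the strategy `σ`. -/
inductive GReachable {St : Type*} (Edge : St → St → Prop) (Init IsSafeSt : St → Prop)
    (σ : St → St) : St → Prop where
  | init {x : St} : Init x → GReachable Edge Init IsSafeSt σ x
  | step {x y : St} : GReachable Edge Init IsSafeSt σ x → Edge x y →
      (IsSafeSt x → y = σ x) → GReachable Edge Init IsSafeSt σ y

theorem GReachable.exists_play {St : Type*} {Edge : St → St → Prop} {Init IsSafeSt : St → Prop}
    {σ : St → St} {x : St} (h : GReachable Edge Init IsSafeSt σ x) :
    ∃ (pl : ℕ → St) (m : ℕ), Init (pl 0) ∧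
      (∀ i < m, Edge (pl i) (pl (i + 1)) ∧ (IsSafeSt (pl i) → pl (i + 1) = σ (pl i))) ∧
      pl m = x := by
  induction h with
  | @init x hx => exact ⟨fun _ => x, 0, hx, by simp, rfl⟩
  | @step x y _ he hs ih =>
    obtain ⟨pl, m, h0, hpl, rfl⟩ := ih
    refine ⟨fun i => if i ≤ m then pl i else y, m + 1, by simpa using h0, fun i hi => ?_, by simp⟩
    rcases Nat.lt_succ_iff_lt_or_eq.1 hi with h | rfl
    · simpa [h.le, Nat.succ_le_of_lt h] using hpl i h
    · simpa using ⟨he, hs⟩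

theorem GWinning.not_bad {St : Type*} {Edge : St → St → Prop} {Init Bad IsSafeSt : St → Prop}
    {σ : St → St} (hwin : GWinning Edge Init Bad IsSafeSt σ) {x : St}
    (h : GReachable Edge Init IsSafeSt σ x) : ¬ Bad x := by
  obtain ⟨pl, m, h0, hpl, rfl⟩ := h.exists_play
  exact hwin.2 pl m h0 hpl

/-- A concrete configuration of a simulated play: copy `i` has followed `path i` up to the
index `pos i`, and `count` letters have been fed to the automaton, which is in state `aut`. -/
structure SimConfig (C : Type*) (k : ℕ) (Q : Type*) where
  path : Fin k → ℕ → C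
  pos : Fin k → ℕ
  aut : Q
  moved : Fin k → Bool
  count : ℕ

/-- The current concrete tuple. -/
def SimConfig.cur {C : Type*} {k : ℕ} {Q : Type*} (x : SimConfig C k Q) : Fin k → C :=
  fun i => x.path i (x.pos i)

/-- One round of a simulated play: either the automaton reads the current tuple, or the
copies in a nonempty scheduling make a step. -/
inductive SimStep {C : Type*} {k : ℕ} (step : Set (C × C)) (ξ : Fin k → Set C)
    (Aut : DSA (Fin k → C)) (x y : SimConfig C k Aut.Q) : Prop where
  | read (E : Set (Fin k → C)) (edge : (x.aut, E, y.aut) ∈ Aut.edges) (mem : x.cur ∈ E)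
      (obs : ∀ i, x.cur i ∈ ξ i) (moved : ∀ i, x.moved i = true)
      (moved' : ∀ i, y.moved i = false) (path : y.path = x.path) (pos : y.pos = x.pos)
      (count : y.count = x.count + 1)
  | sched (M : Set (Fin k)) (nonempty : M.Nonempty)
      (enabled : ∀ i ∈ M, x.moved i = false ∨ x.cur i ∉ ξ i)
      (act : ∀ i ∈ M, y.pos i = x.pos i + 1 ∧ y.moved i = true ∧ (x.cur i, y.cur i) ∈ step)
      (stay : ∀ i ∉ M, y.pos i = x.pos i ∧ y.moved i = x.moved i)
      (path : ∀ i, ∀ m ≤ x.pos i, y.path i m = x.path i m)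
      (aut : y.aut = x.aut) (count : y.count = x.count)

namespace SimStep

variable {C : Type*} {k : ℕ} {step : Set (C × C)} {ξ : Fin k → Set C} {Aut : DSA (Fin k → C)}
  {x y : SimConfig C k Aut.Q}

theorem pos_le (h : SimStep step ξ Aut x y) (i : Fin k) : x.pos i ≤ y.pos i := by
  cases h with
  | read _ _ _ _ _ _ _ hpos => rw [hpos]
  | sched M _ _ act stay =>
    by_cases hi : i ∈ M
    · rw [(act i hi).1]; omega
    · rw [(stay i hi).1]

theorem path_eq (h : SimStep step ξ Aut x y) (i : Fin k) (m : ℕ) (hm : m ≤ x.pos i) :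
    y.path i m = x.path i m := by
  cases h with
  | read _ _ _ _ _ _ hpath => rw [hpath]
  | sched _ _ _ _ _ hpath => exact hpath i m hm

theorem count_le (h : SimStep step ξ Aut x y) : y.count ≤ x.count + 1 := by
  cases h <;> omega

theorem sum_pos_add_count_lt (h : SimStep step ξ Aut x y) :
    ∑ i, x.pos i + x.count < ∑ i, y.pos i + y.count := by
  have hle := h.pos_le
  cases h with
  | read _ _ _ _ _ _ _ hpos hcount => rw [hpos, hcount]; omega
  | sched M hM _ act _ _ _ hcount =>
    obtain ⟨i, hi⟩ := hM
    have := Finset.sum_lt_sum (fun j _ => hle j)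
      ⟨i, Finset.mem_univ i, by rw [(act i hi).1]; omega⟩
    omega

end SimStep

/-- A growing family of stabilizing prefixes has a limit. -/
theorem exists_limit_of_prefixes {C : Type*} (path : ℕ → ℕ → C) (pos : ℕ → ℕ)
    (hpos : Monotone pos) (hpath : ∀ N, ∀ m ≤ pos N, path (N + 1) m = path N m) :
    ∃ u : ℕ → C, (∀ N, ∀ m ≤ pos N, u m = path N m) ∧ ∀ m, ∃ N, u m = path N m := by
  classical
  have stable : ∀ N N', N ≤ N' → ∀ m ≤ pos N, path N' m = path N m := by
    intro N N' hN m hm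
    induction N', hN using Nat.le_induction with
    | base => rfl
    | succ N' hN ih => rw [hpath N' m (hm.trans (hpos hN)), ih]
  refine ⟨fun m => if h : ∃ N, m ≤ pos N then path (Nat.find h) m else path 0 m,
    fun N m hm => ?_, fun m => ?_⟩
  · have h : ∃ N, m ≤ pos N := ⟨N, hm⟩
    simp only [dif_pos h]
    exact (stable _ _ (Nat.find_min' h hm) m (Nat.find_spec h)).symm
  · dsimp only
    split_ifs with h
    · exact ⟨_, rfl⟩
    · exact ⟨0, rfl⟩

theorem exists_seq_of_forall_exists {X : Type*} {P : X → Prop} {R : X → X → Prop} (x₀ : X)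
    (h₀ : P x₀) (h : ∀ x, P x → ∃ y, R x y ∧ P y) :
    ∃ f : ℕ → X, f 0 = x₀ ∧ (∀ N, P (f N)) ∧ ∀ N, R (f N) (f (N + 1)) := by
  choose! g hR hP using h
  have hf : ∀ N, P (g^[N] x₀) := fun N => by
    induction N with
    | zero => exact h₀
    | succ N ih => rw [Function.iterate_succ_apply']; exact hP _ ih
  refine ⟨fun N => g^[N] x₀, rfl, hf, fun N => ?_⟩
  simp only [Function.iterate_succ_apply']
  exact hR _ (hf N)

/-- The edge prescribed at a SAFE-state can be simulated concretely, with the universal copies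
following the given traces. -/
theorem exists_simStep {C : Type*} {k n : ℕ} {l : ℕ} {init : Set C} {step : Set (C × C)}
    {p : Fin n → Set (Fin k → C)} {ξ : Fin k → Set C} {Aut : DSA (Fin k → C)}
    (hobs_expr : ∀ i : Fin k, Expressible p {c : Fin k → C | c i ∈ ξ i})
    (hlabels : ∀ e ∈ Aut.edges, Expressible p e.2.1)
    {σ : GSE n k Aut.Q → GSE n k Aut.Q}
    (hedge : ∀ st, GIsSafeE st → GEdgeTilde p step ξ Aut st (σ st))
    (hvalid : ∀ (s : Fin n → Bool) (q : Aut.Q) (b : Fin k → Bool) (M : Set (Fin k))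
      (R : Set (Fin n → Bool)),
      σ (GSE.safe s q b) = GSE.reach s q b M R → ValidRes step p l s M R)
    {t : Fin k → ℕ → C}
    (ht : ∀ i : Fin k, (i : ℕ) < l → ∀ m, (t i m, t i (m + 1)) ∈ step)
    (x : SimConfig C k Aut.Q) (hx : ∀ i : Fin k, (i : ℕ) < l → x.path i = t i)
    (hreach : GReachable (GEdgeTilde p step ξ Aut) (GInitE p init Aut) GIsSafeE σ
      (GSE.safe (absState p x.cur) x.aut x.moved)) :
    ∃ y : SimConfig C k Aut.Q, SimStep step ξ Aut x y ∧
      (∀ i : Fin k, (i : ℕ) < l → y.path i = t i) ∧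
      GReachable (GEdgeTilde p step ξ Aut) (GInitE p init Aut) GIsSafeE σ
        (GSE.safe (absState p y.cur) y.aut y.moved) := by
  classical
  have hobs : ∀ i, obsAt p ξ (absState p x.cur) i ↔ x.cur i ∈ ξ i :=
    fun i => (hobs_expr i).conc_inter_nonempty_iff x.cur
  have he := hedge (GSE.safe (absState p x.cur) x.aut x.moved) trivial
  have hnext := hreach.step he fun _ => rfl
  generalize hst : GSE.safe (absState p x.cur) x.aut x.moved = st at he
  generalize hst' : σ st = st' at he
  rw [hst, hst'] at hnext
  cases he with
  | move => cases hst
  | @auto s q q' E hall hE hne =>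
    injection hst with hs hq hb
    subst hs hq
    refine ⟨⟨x.path, x.pos, q', fun _ => false, x.count + 1⟩, ?_, hx, hnext⟩
    exact .read E hE (((hlabels _ hE).conc_inter_nonempty_iff x.cur).1 hne)
      (fun i => (hobs i).1 (hall i)) (fun i => congrFun hb i) (fun _ => rfl) rfl rfl rfl
  | @sched s q b M R hM hen _ _ =>
    injection hst with hs hq hb
    subst hs hq hb
    obtain ⟨c', hu, hex, s', hs'R, hs'⟩ := hvalid _ _ _ _ _ hst' x.cur (mem_conc_absState p _)
      (fun i => if i ∈ M then t i (x.pos i + 1) else t i (x.pos i)) (fun i hi => by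
        constructor
        · intro hiM
          simpa [hiM, SimConfig.cur, hx i hi] using ht i hi (x.pos i)
        · intro hiM
          simp [hiM, SimConfig.cur, hx i hi])
    let y : SimConfig C k Aut.Q :=
      { path := fun i m => if (i : ℕ) < l then t i m else if m ≤ x.pos i then x.path i m else c' i
        pos := fun i => if i ∈ M then x.pos i + 1 else x.pos i
        aut := x.aut
        moved := fun i => if i ∈ M then true else x.moved i
        count := x.count }
    have hcur : y.cur = c' := by
      funext i
      by_cases hi : (i : ℕ) < l <;> by_cases hiM : i ∈ M
      · simp [y, SimConfig.cur, hi, hiM, hu i hi]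
      · simp [y, SimConfig.cur, hi, hiM, hu i hi]
      · simp [y, SimConfig.cur, hi, hiM]
      · simp [y, SimConfig.cur, hi, hiM, (hex i (not_lt.1 hi)).2 hiM]
    refine ⟨y, .sched M hM (fun i hi => ?_) (fun i hi => ⟨by simp [y, hi], by simp [y, hi], ?_⟩)
      (fun i hi => ⟨by simp [y, hi], by simp [y, hi]⟩) (fun i m hm => ?_) rfl rfl,
      fun i hi => by simp [y, hi], ?_⟩
    · rw [← hobs i]
      exact hen i hi
    · rw [hcur]
      by_cases hil : (i : ℕ) < l
      · simpa [hu i hil, hi, SimConfig.cur, hx i hil] using ht i hil (x.pos i)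
      · exact (hex i (not_lt.1 hil)).1 hi
    · by_cases hi : (i : ℕ) < l
      · simp [y, hi, hx i hi]
      · simp [y, hi, hm]
    · rw [hcur, ← mem_conc_iff.1 hs']
      exact hnext.step (.move hs'R (fun i hi => by simp [y, hi]) fun i hi => by simp [y, hi])
        (fun h => h.elim)

/-- A simulated play whose copies stay on the sequences `u`, starting at index `0`. -/
structure IsSimulation {C : Type*} {k : ℕ} (step : Set (C × C)) (ξ : Fin k → Set C)
    (Aut : DSA (Fin k → C)) (u : Fin k → ℕ → C) (f : ℕ → SimConfig C k Aut.Q) : Prop where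
  pos_zero : ∀ i, (f 0).pos i = 0
  moved_zero : ∀ i, (f 0).moved i = true
  count_zero : (f 0).count = 0
  aut_zero : (f 0).aut = Aut.q0
  simStep : ∀ N, SimStep step ξ Aut (f N) (f (N + 1))
  path_eq : ∀ N i, ∀ m ≤ (f N).pos i, u i m = (f N).path i m

namespace IsSimulation

variable {C : Type*} {k : ℕ} {step : Set (C × C)} {ξ : Fin k → Set C} {Aut : DSA (Fin k → C)}
  {u : Fin k → ℕ → C} {f : ℕ → SimConfig C k Aut.Q}

theorem cur_eq (h : IsSimulation step ξ Aut u f) (N : ℕ) (i : Fin k) :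
    (f N).cur i = u i ((f N).pos i) :=
  (h.path_eq N i _ le_rfl).symm

theorem step_mem (h : IsSimulation step ξ Aut u f) (i : Fin k) (N m : ℕ)
    (hm : m < (f N).pos i) : (u i m, u i (m + 1)) ∈ step := by
  induction N with
  | zero => simp [h.pos_zero] at hm
  | succ N ih =>
    cases h.simStep N with
    | read _ _ _ _ _ _ _ hpos => exact ih (by rwa [hpos] at hm)
    | sched M _ _ act stay =>
      by_cases hi : i ∈ M
      · obtain ⟨hpos, _, hstep⟩ := act i hi
        rcases Nat.lt_succ_iff_lt_or_eq.1 (hpos ▸ hm) with hlt | rfl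
        · exact ih hlt
        · rwa [h.cur_eq, h.cur_eq, hpos] at hstep
      · exact ih (by rwa [(stay i hi).1] at hm)

open Classical in
/-- The number of observation points of copy `i` passed so far agrees with the number of letters
read by the automaton; the current point is included iff the copy has not moved since. -/
theorem count_eq (h : IsSimulation step ξ Aut u f) (N : ℕ) (i : Fin k) :
    Nat.count (fun m => u i m ∈ ξ i)
      (if (f N).moved i then (f N).pos i else (f N).pos i + 1) = (f N).count := by
  induction N with
  | zero => simp [h.pos_zero, h.moved_zero, h.count_zero]
  | succ N ih =>
    cases h.simStep N with
    | read _ _ _ obs moved moved' _ hpos hcount =>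
      have ho := obs i
      rw [h.cur_eq] at ho
      simp only [moved, if_true] at ih
      simp [moved', hpos, hcount, Nat.count_succ, ih, ho]
    | sched M _ enabled act stay _ _ hcount =>
      rw [hcount, ← ih]
      by_cases hi : i ∈ M
      · obtain ⟨hpos, hmoved, -⟩ := act i hi
        have hen := enabled i hi
        rw [h.cur_eq] at hen
        cases hb : (f N).moved i
        · simp [hpos, hmoved]
        · have ho : u i ((f N).pos i) ∉ ξ i := by simpa [hb] using hen
          simp [hpos, hmoved, Nat.count_succ, ho]
      · rw [(stay i hi).1, (stay i hi).2]

theorem count_le_pos (h : IsSimulation step ξ Aut u f) (N : ℕ) (i : Fin k) :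
    (f N).count ≤ (f N).pos i + 1 := by
  classical
  rw [← h.count_eq N i]
  refine (Nat.count_le _).trans ?_
  split_ifs <;> omega

theorem le_sum_pos_add_count (h : IsSimulation step ξ Aut u f) (N : ℕ) :
    N ≤ ∑ i, (f N).pos i + (f N).count := by
  induction N with
  | zero => exact Nat.zero_le _
  | succ N ih => have := (h.simStep N).sum_pos_add_count_lt; omega

theorem exists_unbounded_pos [NeZero k] (h : IsSimulation step ξ Aut u f) :
    ∃ i, ∀ m, ∃ N, m ≤ (f N).pos i := by
  by_contra! hb
  choose B hB using hb
  let N := ∑ i, B i + B 0 + 1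
  have hsum : ∑ i, (f N).pos i ≤ ∑ i, B i := Finset.sum_le_sum fun i _ => (hB i N).le
  have hN := h.le_sum_pos_add_count N
  have hc := h.count_le_pos N 0
  have h0 := hB 0 N
  omega

theorem unbounded_count (h : IsSimulation step ξ Aut u f) {i : Fin k}
    (hi : ∀ m, ∃ N, m ≤ (f N).pos i) (hobs : ValidObs (ξ i) (u i)) (j : ℕ) :
    ∃ N, j ≤ (f N).count := by
  classical
  obtain ⟨N, hN⟩ := hi (Nat.nth (fun m => u i m ∈ ξ i) j)
  refine ⟨N, ?_⟩
  rw [← h.count_eq N i, ← Nat.count_nth_of_infinite hobs j]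
  refine Nat.count_monotone _ (hN.trans ?_)
  split_ifs <;> omega

theorem unbounded_pos (h : IsSimulation step ξ Aut u f) (hc : ∀ j, ∃ N, j ≤ (f N).count)
    (i : Fin k) (m : ℕ) : ∃ N, m ≤ (f N).pos i := by
  obtain ⟨N, hN⟩ := hc (m + 1)
  have := h.count_le_pos N i
  exact ⟨N, by omega⟩

theorem exists_count_eq (h : IsSimulation step ξ Aut u f) (hc : ∀ j, ∃ N, j ≤ (f N).count)
    (j : ℕ) : ∃ N, (f N).count = j := by
  classical
  have hspec := Nat.find_spec (hc j)
  rcases hN : Nat.find (hc j) with _ | N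
  · rw [hN, h.count_zero] at hspec
    exact ⟨0, by rw [h.count_zero]; omega⟩
  · have hlt := Nat.find_min (hc j) (m := N) (by omega)
    have hle := (h.simStep N).count_le
    rw [hN] at hspec
    exact ⟨N + 1, by omega⟩

theorem run_eq (h : IsSimulation step ξ Aut u f) {r : ℕ → Aut.Q}
    (hr : IsRun Aut (fun j i => filterTrace (u i) (ξ i) j) r) (N : ℕ) :
    r (f N).count = (f N).aut := by
  classical
  induction N with
  | zero => rw [h.count_zero, hr.1, h.aut_zero]
  | succ N ih =>
    cases h.simStep N with
    | sched _ _ _ _ _ _ haut hcount => rw [hcount, haut, ih]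
    | read E edge mem obs moved _ _ _ hcount =>
      have hletter : (fun i => filterTrace (u i) (ξ i) (f N).count) = (f N).cur := by
        funext i
        have hce := h.count_eq N i
        have ho := obs i
        rw [h.cur_eq] at ho ⊢
        simp only [moved, if_true] at hce
        rw [filterTrace, ← hce, Nat.nth_count (p := fun m => u i m ∈ ξ i) ho]
      obtain ⟨E', hE', hmem⟩ := hr.2 (f N).count
      beta_reduce at hmem
      rw [hletter] at hmem
      have := (Aut.det (f N).aut (f N).cur).unique ⟨hE', ih, hmem⟩ ⟨edge, rfl, mem⟩
      rw [hcount]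
      exact congrArg (fun e => e.2.2) this

end IsSimulation

/-- soundness of the lazy refinement loop (Algorithm 1 returning SAFE).
Under the assumptions of Theorem 3, if SAFE has a positional winning strategy `σ` in
the relaxed game `G̃` such that every restriction edge prescribed by `σ` is a valid
restriction, then for all traces assigned to the universally quantified copies
(`i < l`, with valid observations) there exist traces for the existentially
quantified copies such that the zipped word of filtered traces is accepted by the
automaton. -/
theorem lazy_refinement_soundness {C : Type*} {k n : ℕ} (hk : 1 ≤ k)
    (l : ℕ) (hl : l ≤ k)
    (init : Set C) (step : Set (C × C)) (c0 : C) (hsingleton : init = {c0})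
    (p : Fin n → Set (Fin k → C)) (ξ : Fin k → Set C)
    (Aut : DSA (Fin k → C))
    (hinit_expr : Expressible p {c : Fin k → C | ∀ i, c i ∈ init})
    (hobs_expr : ∀ i : Fin k, Expressible p {c : Fin k → C | c i ∈ ξ i})
    (hlabels : ∀ e ∈ Aut.edges, Expressible p e.2.1)
    (hexist_obs : ∀ t : ℕ → C, IsTrace init step t →
      ∀ i : Fin k, l ≤ (i : ℕ) → ValidObs (ξ i) t)
    (σ : GSE n k Aut.Q → GSE n k Aut.Q)
    (hwin : GWinning (GEdgeTilde p step ξ Aut) (GInitE p init Aut) (GBadE Aut.Bad)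
      GIsSafeE σ)
    (hvalid : ∀ (s : Fin n → Bool) (q : Aut.Q) (b : Fin k → Bool) (M : Set (Fin k))
      (R : Set (Fin n → Bool)),
      σ (GSE.safe s q b) = GSE.reach s q b M R → ValidRes step p l s M R)
    (t : Fin k → ℕ → C)
    (ht : ∀ i : Fin k, (i : ℕ) < l → IsTrace init step (t i))
    (hv : ∀ i : Fin k, (i : ℕ) < l → ValidObs (ξ i) (t i)) :
    ∃ t' : Fin k → ℕ → C,
      (∀ i : Fin k, (i : ℕ) < l → t' i = t i) ∧
      (∀ i : Fin k, IsTrace init step (t' i)) ∧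
      Accepted Aut (fun j => fun i => filterTrace (t' i) (ξ i) j) := by
  classical
  subst hsingleton
  have : NeZero k := ⟨by omega⟩
  let x₀ : SimConfig C k Aut.Q :=
    { path := fun i => if (i : ℕ) < l then t i else fun _ => c0
      pos := fun _ => 0
      aut := Aut.q0
      moved := fun _ => true
      count := 0 }
  have hx₀ : ∀ i, x₀.path i 0 = c0 := fun i => by
    by_cases hi : (i : ℕ) < l
    · simpa [x₀, hi] using (ht i hi).1
    · simp [x₀, hi]
  obtain ⟨f, hf0, hP, hR⟩ := exists_seq_of_forall_exists
    (P := fun x : SimConfig C k Aut.Q => (∀ i : Fin k, (i : ℕ) < l → x.path i = t i) ∧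
      GReachable (GEdgeTilde p step ξ Aut) (GInitE p {c0} Aut) GIsSafeE σ
        (GSE.safe (absState p x.cur) x.aut x.moved))
    x₀ ⟨fun i hi => by simp [x₀, hi],
      .init ⟨_, rfl, x₀.cur, mem_conc_absState p _, fun i => hx₀ i⟩⟩
    (fun x hx => exists_simStep hobs_expr hlabels hwin.1 hvalid (fun i hi => (ht i hi).2)
      x hx.1 hx.2)
  have hlim := fun i => exists_limit_of_prefixes (fun N => (f N).path i) (fun N => (f N).pos i)
    (monotone_nat_of_le_succ fun N => (hR N).pos_le i) (fun N => (hR N).path_eq i)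
  choose u hu hu' using hlim
  have hsim : IsSimulation step ξ Aut u f :=
    ⟨fun i => by rw [hf0], fun i => by rw [hf0], by rw [hf0], by rw [hf0], hR,
      fun N i => hu i N⟩
  have hut : ∀ i : Fin k, (i : ℕ) < l → u i = t i := fun i hi => by
    funext m
    obtain ⟨N, hN⟩ := hu' i m
    rw [hN, (hP N).1 i hi]
  have htrace : ∀ i, (∀ m, ∃ N, m ≤ (f N).pos i) → IsTrace {c0} step (u i) := by
    refine fun i hi => ⟨?_, fun m => ?_⟩
    · have h0 := hu i 0 0 (Nat.zero_le _)
      simp only [hf0, hx₀] at h0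
      exact h0
    · obtain ⟨N, hN⟩ := hi (m + 1)
      exact hsim.step_mem i N m hN
  obtain ⟨i, hi⟩ := hsim.exists_unbounded_pos
  have hobs : ValidObs (ξ i) (u i) := by
    by_cases hil : (i : ℕ) < l
    · rw [hut i hil]; exact hv i hil
    · exact hexist_obs _ (htrace i hi) i (not_lt.1 hil)
  have hcount := hsim.unbounded_count hi hobs
  refine ⟨u, hut, fun i => htrace i (hsim.unbounded_pos hcount i), fun r hr j => ?_⟩
  obtain ⟨N, rfl⟩ := hsim.exists_count_eq hcount j
  rw [hsim.run_eq hr N]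
  exact hwin.not_bad (hP N).2
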